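/- (Main theorem, cone observables) Fix 0 < α < 1 and a ≥ 2^α(2+α)/(1−α). There exists a constant C_α depending only on α (and a) such that for all φ, ψ ∈ C₂ with ∫ φ dm = ∫ ψ dm, every n > 1, and every sequence β₁, …, β_n ∈ (0, α], one has ∫ |P_{β_n} ∘ ⋯ ∘ P_{β_1} φ − P_{β_n} ∘ ⋯ ∘ P_{β_1} ψ| dm ≤ C_α (‖φ‖_{L¹(m)} + ‖ψ‖_{L¹(m)}) n^{1 − 1/α} (log n)^{1/α}. -/

import Mathlib

open MeasureTheory Set

/-- The Pomeau–Manneville type map `T_β` on `[0,1]` (identified with the circle `S¹`):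
`T_β x = x + 3^β/2^(1+β) x^(1+β)` for `x ≤ 2/3` and `T_β x = 3x - 2` otherwise. -/
noncomputable def Tmap (β x : ℝ) : ℝ :=
  if x ≤ 2/3 then x + (3:ℝ)^β / 2^(1+β) * x^(1+β) else 3*x - 2

/-- The derivative of `T_β` (left-branch formula at `x ≤ 2/3`). -/
noncomputable def Tderiv (β x : ℝ) : ℝ :=
  if x ≤ 2/3 then 1 + (3:ℝ)^β / 2^(1+β) * (1+β) * x^β else 3

/-- The second derivative of `T_β`. -/
noncomputable def Tderiv2 (β x : ℝ) : ℝ :=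
  if x ≤ 2/3 then (3:ℝ)^β / 2^(1+β) * (1+β) * β * x^(β-1) else 0

/-- The inverse of the left branch of `T_β` (for `x ∈ [0,1]` this is the unique
`y ∈ [0,2/3]` with `T_β y = x`). -/
noncomputable def leftInv (β x : ℝ) : ℝ :=
  sSup {y : ℝ | y ∈ Set.Icc (0:ℝ) (2/3) ∧ Tmap β y ≤ x}

/-- The Perron–Frobenius transfer operator of `T_β` with respect to Lebesgue measure:
`P_β f (x) = ∑_{y ∈ T_β⁻¹ x} f y / T_β' y`; the right branch preimage of `x` is `(x+2)/3`,
where the derivative is `3`. -/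
noncomputable def Pop (β : ℝ) (f : ℝ → ℝ) (x : ℝ) : ℝ :=
  f (leftInv β x) / Tderiv β (leftInv β x) + f ((x+2)/3) / 3

/-- `P_{β_{k+n}} ∘ ⋯ ∘ P_{β_{k+1}}`. -/
noncomputable def PopCompFrom (β : ℕ → ℝ) (k : ℕ) : ℕ → (ℝ → ℝ) → ℝ → ℝ
  | 0, f => f
  | n+1, f => Pop (β (k+n+1)) (PopCompFrom β k n f)

/-- `P_{β_n} ∘ ⋯ ∘ P_{β_1}`. -/
noncomputable def PopComp (β : ℕ → ℝ) (n : ℕ) : (ℝ → ℝ) → ℝ → ℝ :=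
  PopCompFrom β 0 n

/-- `T_{β_{k+n}} ∘ ⋯ ∘ T_{β_{k+1}}`. -/
noncomputable def TcompFrom (β : ℕ → ℝ) (k : ℕ) : ℕ → ℝ → ℝ
  | 0, x => x
  | n+1, x => Tmap (β (k+n+1)) (TcompFrom β k n x)

/-- The derivative `(T_{β_{k+n}} ∘ ⋯ ∘ T_{β_{k+1}})'(z)`, computed as the product of the
derivatives along the orbit of `z`. -/
noncomputable def DcompFrom (β : ℕ → ℝ) (k n : ℕ) (z : ℝ) : ℝ :=
  ∏ i ∈ Finset.range n, Tderiv (β (k+i+1)) (TcompFrom β k i z)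

/-- The averaging operator `A_ε f (x) = (1/(2ε)) ∫_{B_ε(x)} f dm` on the circle,
realized via the 1-periodic extension of `f`. -/
noncomputable def Aop (ε : ℝ) (f : ℝ → ℝ) (x : ℝ) : ℝ :=
  (1/(2*ε)) * ∫ t in (x-ε)..(x+ε), f (Int.fract t)

/-- The indicator function of the ball `B_ε(z)` of radius `ε` around `z` in the circle `ℝ/ℤ`. -/
noncomputable def ballInd (ε z : ℝ) : ℝ → ℝ :=
  Set.indicator {y : ℝ | ∃ k : ℤ, |y - z - (k:ℝ)| < ε} (fun _ => 1)

/-- The cone `C₁ = {f ∈ C⁰((0,1]) : f ≥ 0, f decreasing, x ↦ x^(α+1) f x increasing}`. -/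
def memC1 (α : ℝ) (f : ℝ → ℝ) : Prop :=
  ContinuousOn f (Set.Ioc 0 1) ∧ (∀ x ∈ Set.Ioc (0:ℝ) 1, 0 ≤ f x) ∧
  AntitoneOn f (Set.Ioc 0 1) ∧ MonotoneOn (fun x : ℝ => x^(α+1) * f x) (Set.Ioc 0 1)

/-- `m(f) = ∫₀¹ f dm` (Lebesgue). -/
noncomputable def mInt (f : ℝ → ℝ) : ℝ := ∫ x in Set.Ioc (0:ℝ) 1, f x

/-- The cone `C₂ = {f ∈ C₁ ∩ L¹(m) : f x ≤ a x^(-α) m(f)}`. -/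
def memC2 (α a : ℝ) (f : ℝ → ℝ) : Prop :=
  memC1 α f ∧ IntegrableOn f (Set.Ioc 0 1) volume ∧
  ∀ x ∈ Set.Ioc (0:ℝ) 1, f x ≤ a * x^(-α) * mInt f

/-- The `L¹(m)` norm on `[0,1]`. -/
noncomputable def L1norm (f : ℝ → ℝ) : ℝ := ∫ x in Set.Ioc (0:ℝ) 1, |f x|

/-- The `C¹` norm `‖f‖_∞ + ‖f'‖_∞` on the circle. -/
noncomputable def C1norm (f : ℝ → ℝ) : ℝ :=
  (⨆ x : Set.Icc (0:ℝ) 1, |f (x:ℝ)|) + ⨆ x : Set.Icc (0:ℝ) 1, |deriv f (x:ℝ)|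

section LeftBranch

variable {β : ℝ}

lemma coef_mul_rpow {y : ℝ} (hy : 0 ≤ y) :
    (3:ℝ)^β / 2^(1+β) * y^β = (3/2*y)^β / 2 := by
  rw [Real.mul_rpow (by norm_num) hy, Real.div_rpow (by norm_num) (by norm_num),
    Real.rpow_add (by norm_num), Real.rpow_one]
  have : (0:ℝ) < 2^β := by positivity
  field_simp

lemma Tmap_left (hβ : β ∈ Ioc (0:ℝ) 1) {y : ℝ} (hy : y ∈ Icc (0:ℝ) (2/3)) :
    Tmap β y = y * (1 + (3/2*y)^β / 2) := by
  rw [Tmap, if_pos hy.2, ← coef_mul_rpow hy.1,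
    Real.rpow_one_add' hy.1 (by linarith [hβ.1])]
  ring

lemma Tderiv_left {y : ℝ} (hy : y ∈ Icc (0:ℝ) (2/3)) :
    Tderiv β y = 1 + (1+β) * ((3/2*y)^β / 2) := by
  rw [Tderiv, if_pos hy.2, ← coef_mul_rpow hy.1]
  ring

lemma rpow_three_halves_mul_mem (hβ : β ∈ Ioc (0:ℝ) 1) {y : ℝ} (hy : y ∈ Icc (0:ℝ) (2/3)) :
    (3/2*y)^β ∈ Icc (0:ℝ) 1 :=
  ⟨Real.rpow_nonneg (by linarith [hy.1]) _,
    Real.rpow_le_one (by linarith [hy.1]) (by linarith [hy.2]) hβ.1.le⟩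

lemma Tderiv_left_mem (hβ : β ∈ Ioc (0:ℝ) 1) {y : ℝ} (hy : y ∈ Icc (0:ℝ) (2/3)) :
    Tderiv β y ∈ Icc (1:ℝ) 2 := by
  rw [Tderiv_left hy]
  have h := rpow_three_halves_mul_mem hβ hy
  constructor <;> nlinarith [h.1, h.2, hβ.1, hβ.2]

lemma Tderiv_left_mono (hβ : β ∈ Ioc (0:ℝ) 1) : MonotoneOn (Tderiv β) (Icc (0:ℝ) (2/3)) := by
  intro x hx y hy hxy
  rw [Tderiv_left hx, Tderiv_left hy]
  have : (3/2*x)^β ≤ (3/2*y)^β :=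
    Real.rpow_le_rpow (by linarith [hx.1]) (by linarith) hβ.1.le
  nlinarith [hβ.1]

lemma Tmap_left_strictMono (hβ : β ∈ Ioc (0:ℝ) 1) :
    StrictMonoOn (Tmap β) (Icc (0:ℝ) (2/3)) := by
  intro x hx y hy hxy
  rw [Tmap_left hβ hx, Tmap_left hβ hy]
  have h : (3/2*x)^β ≤ (3/2*y)^β :=
    Real.rpow_le_rpow (by linarith [hx.1]) (by linarith) hβ.1.le
  have h0 := (rpow_three_halves_mul_mem hβ hx).1
  nlinarith [hx.1]

lemma Tmap_left_continuousOn (hβ : β ∈ Ioc (0:ℝ) 1) :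
    ContinuousOn (Tmap β) (Icc (0:ℝ) (2/3)) := by
  refine ContinuousOn.congr (f := fun y => y * (1 + (3/2*y)^β / 2)) ?_
    fun y hy => Tmap_left hβ hy
  have : Continuous fun y : ℝ => (3/2*y)^β :=
    (continuous_const.mul continuous_id).rpow_const fun _ => Or.inr hβ.1.le
  fun_prop

lemma Tmap_zero (hβ : β ∈ Ioc (0:ℝ) 1) : Tmap β 0 = 0 := by
  rw [Tmap_left hβ (by norm_num)]; simp

lemma Tmap_two_thirds (hβ : β ∈ Ioc (0:ℝ) 1) : Tmap β (2/3) = 1 := by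
  rw [Tmap_left hβ (by norm_num)]; norm_num

lemma leftInv_Tmap (hβ : β ∈ Ioc (0:ℝ) 1) {y : ℝ} (hy : y ∈ Icc (0:ℝ) (2/3)) :
    leftInv β (Tmap β y) = y := by
  have : {z : ℝ | z ∈ Icc (0:ℝ) (2/3) ∧ Tmap β z ≤ Tmap β y} = Icc 0 y := by
    ext z
    constructor
    · rintro ⟨hz, h⟩
      exact ⟨hz.1, ((Tmap_left_strictMono hβ).le_iff_le hz hy).1 h⟩
    · rintro ⟨h0, h⟩
      have hz : z ∈ Icc (0:ℝ) (2/3) := ⟨h0, h.trans hy.2⟩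
      exact ⟨hz, ((Tmap_left_strictMono hβ).le_iff_le hz hy).2 h⟩
  rw [leftInv, this, csSup_Icc hy.1]

lemma exists_Tmap_eq (hβ : β ∈ Ioc (0:ℝ) 1) {x : ℝ} (hx : x ∈ Icc (0:ℝ) 1) :
    ∃ y ∈ Icc (0:ℝ) (2/3), Tmap β y = x := by
  have h := intermediate_value_Icc (by norm_num : (0:ℝ) ≤ 2/3) (Tmap_left_continuousOn hβ)
  rw [Tmap_zero hβ, Tmap_two_thirds hβ] at h
  exact h hx

lemma leftInv_mem_Icc (hβ : β ∈ Ioc (0:ℝ) 1) {x : ℝ} (hx : x ∈ Icc (0:ℝ) 1) :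
    leftInv β x ∈ Icc (0:ℝ) (2/3) := by
  obtain ⟨y, hy, rfl⟩ := exists_Tmap_eq hβ hx
  rwa [leftInv_Tmap hβ hy]

lemma Tmap_leftInv (hβ : β ∈ Ioc (0:ℝ) 1) {x : ℝ} (hx : x ∈ Icc (0:ℝ) 1) :
    Tmap β (leftInv β x) = x := by
  obtain ⟨y, hy, rfl⟩ := exists_Tmap_eq hβ hx
  rw [leftInv_Tmap hβ hy]

lemma leftInv_mono (hβ : β ∈ Ioc (0:ℝ) 1) : MonotoneOn (leftInv β) (Icc (0:ℝ) 1) := by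
  intro x hx y hy hxy
  rw [← (Tmap_left_strictMono hβ).le_iff_le (leftInv_mem_Icc hβ hx) (leftInv_mem_Icc hβ hy),
    Tmap_leftInv hβ hx, Tmap_leftInv hβ hy]
  exact hxy

lemma leftInv_one (hβ : β ∈ Ioc (0:ℝ) 1) : leftInv β 1 = 2/3 := by
  rw [← Tmap_two_thirds hβ, leftInv_Tmap hβ (by norm_num)]

lemma leftInv_pos (hβ : β ∈ Ioc (0:ℝ) 1) {x : ℝ} (hx : x ∈ Ioc (0:ℝ) 1) :
    0 < leftInv β x := by
  have h := leftInv_mem_Icc hβ (Ioc_subset_Icc_self hx)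
  rcases h.1.lt_or_eq with h0 | h0
  · exact h0
  · have := Tmap_leftInv hβ (Ioc_subset_Icc_self hx)
    rw [← h0, Tmap_zero hβ] at this
    exact absurd this hx.1.ne

lemma leftInv_mem_Ioc (hβ : β ∈ Ioc (0:ℝ) 1) {x : ℝ} (hx : x ∈ Ioc (0:ℝ) 1) :
    leftInv β x ∈ Ioc (0:ℝ) 1 :=
  ⟨leftInv_pos hβ hx,
    (leftInv_mem_Icc hβ (Ioc_subset_Icc_self hx)).2.trans (by norm_num)⟩

lemma right_preimage_mem {x : ℝ} (hx : x ∈ Ioc (0:ℝ) 1) : (x+2)/3 ∈ Ioc (0:ℝ) 1 :=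
  ⟨by linarith [hx.1], by linarith [hx.2]⟩

lemma Tderiv_leftInv_mem (hβ : β ∈ Ioc (0:ℝ) 1) {x : ℝ} (hx : x ∈ Icc (0:ℝ) 1) :
    Tderiv β (leftInv β x) ∈ Icc (1:ℝ) 2 :=
  Tderiv_left_mem hβ (leftInv_mem_Icc hβ hx)

lemma Tmap_left_hasDerivWithinAt (hβ : β ∈ Ioc (0:ℝ) 1) {y : ℝ} (hy : y ∈ Icc (0:ℝ) (2/3))
    (s : Set ℝ) (hs : s ⊆ Iic (2/3)) : HasDerivWithinAt (Tmap β) (Tderiv β y) s y := by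
  have h : HasDerivAt (fun x : ℝ => x + (3:ℝ)^β / 2^(1+β) * x^(1+β))
      (1 + (3:ℝ)^β / 2^(1+β) * ((1+β) * y^(1+β-1))) y :=
    (hasDerivAt_id y).add
      ((Real.hasDerivAt_rpow_const (Or.inr (by linarith [hβ.1]))).const_mul _)
  have e : Tderiv β y = 1 + (3:ℝ)^β / 2^(1+β) * ((1+β) * y^(1+β-1)) := by
    rw [Tderiv, if_pos hy.2, add_sub_cancel_left]; ring
  rw [e]
  exact h.hasDerivWithinAt.congr (fun x hx => by rw [Tmap, if_pos (mem_Iic.1 (hs hx))])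
    (by rw [Tmap, if_pos hy.2])

lemma Tmap_image_Ioc (hβ : β ∈ Ioc (0:ℝ) 1) {u : ℝ} (hu : u ∈ Icc (0:ℝ) 1) :
    Tmap β '' Ioc (leftInv β u) (2/3) = Ioc u 1 := by
  have hu' := leftInv_mem_Icc hβ hu
  ext x
  constructor
  · rintro ⟨y, hy, rfl⟩
    have hy' : y ∈ Icc (0:ℝ) (2/3) := ⟨hu'.1.trans hy.1.le, hy.2⟩
    constructor
    · rw [← Tmap_leftInv hβ hu]
      exact Tmap_left_strictMono hβ hu' hy' hy.1
    · rw [← Tmap_two_thirds hβ]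
      exact (Tmap_left_strictMono hβ).monotoneOn hy' (by norm_num) hy.2
  · intro hx
    have hx' : x ∈ Icc (0:ℝ) 1 := ⟨hu.1.trans hx.1.le, hx.2⟩
    have hy := leftInv_mem_Icc hβ hx'
    refine ⟨leftInv β x, ⟨?_, hy.2⟩, Tmap_leftInv hβ hx'⟩
    rw [← (Tmap_left_strictMono hβ).lt_iff_lt hu' hy, Tmap_leftInv hβ hu, Tmap_leftInv hβ hx']
    exact hx.1

end LeftBranch

section Operators

/-- The contribution of the left branch to the transfer operator. -/
noncomputable def leftOp (β : ℝ) (f : ℝ → ℝ) (x : ℝ) : ℝ :=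
  f (leftInv β x) / Tderiv β (leftInv β x)

/-- The contribution of the right branch to the transfer operator. -/
noncomputable def rightOp (f : ℝ → ℝ) (x : ℝ) : ℝ := f ((x+2)/3) / 3

variable {β : ℝ} {f g : ℝ → ℝ}

lemma leftOp_smul_comp (hβ : β ∈ Ioc (0:ℝ) 1) {y : ℝ} (hy : y ∈ Icc (0:ℝ) (2/3)) :
    |Tderiv β y| • leftOp β f (Tmap β y) = f y := by
  have h := Tderiv_left_mem hβ hy
  rw [leftOp, leftInv_Tmap hβ hy, abs_of_pos (by linarith [h.1]), smul_eq_mul]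
  have : Tderiv β y ≠ 0 := by linarith [h.1]
  field_simp

lemma setIntegral_leftOp (hβ : β ∈ Ioc (0:ℝ) 1) {u : ℝ} (hu : u ∈ Icc (0:ℝ) 1) :
    ∫ x in Ioc u 1, leftOp β f x = ∫ y in Ioc (leftInv β u) (2/3), f y := by
  have hu' := leftInv_mem_Icc hβ hu
  have hsub : Ioc (leftInv β u) (2/3) ⊆ Icc (0:ℝ) (2/3) := fun y hy => ⟨hu'.1.trans hy.1.le, hy.2⟩
  rw [← Tmap_image_Ioc hβ hu, integral_image_eq_integral_abs_deriv_smul measurableSet_Ioc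
    (fun y hy => Tmap_left_hasDerivWithinAt hβ (hsub hy) _ fun _ h => h.2)
    ((Tmap_left_strictMono hβ).injOn.mono hsub)]
  exact setIntegral_congr_fun measurableSet_Ioc fun y hy => leftOp_smul_comp hβ (hsub hy)

lemma leftInv_zero (hβ : β ∈ Ioc (0:ℝ) 1) : leftInv β 0 = 0 := by
  rw [← Tmap_zero hβ, leftInv_Tmap hβ (by norm_num), Tmap_zero hβ]

lemma integrableOn_leftOp (hβ : β ∈ Ioc (0:ℝ) 1) (hf : IntegrableOn f (Ioc 0 1)) :
    IntegrableOn (leftOp β f) (Ioc 0 1) := by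
  have him := Tmap_image_Ioc hβ (u := 0) (by norm_num)
  rw [leftInv_zero hβ] at him
  have hsub : Ioc (0:ℝ) (2/3) ⊆ Icc (0:ℝ) (2/3) := Ioc_subset_Icc_self
  rw [← him, integrableOn_image_iff_integrableOn_abs_deriv_smul measurableSet_Ioc
    (fun y hy => Tmap_left_hasDerivWithinAt hβ (hsub hy) _ fun _ h => h.2)
    ((Tmap_left_strictMono hβ).injOn.mono hsub)]
  exact (hf.mono_set (Ioc_subset_Ioc_right (by norm_num))).congr_fun
    (fun y hy => (leftOp_smul_comp hβ (hsub hy)).symm) measurableSet_Ioc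

lemma image_right_branch : (fun y : ℝ => 3*y - 2) '' Ioc (2/3) 1 = Ioc (0:ℝ) 1 := by
  ext x
  constructor
  · rintro ⟨y, hy, rfl⟩
    exact ⟨by linarith [hy.1], by linarith [hy.2]⟩
  · intro hx
    exact ⟨(x+2)/3, ⟨by linarith [hx.1], by linarith [hx.2]⟩, by ring⟩

lemma hasDerivWithinAt_right_branch (s : Set ℝ) (y : ℝ) :
    HasDerivWithinAt (fun y : ℝ => 3*y - 2) 3 s y := by
  simpa using (((hasDerivAt_id y).const_mul (3:ℝ)).sub_const 2).hasDerivWithinAt (s := s)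

lemma rightOp_smul_comp (y : ℝ) : |(3:ℝ)| • rightOp f (3*y - 2) = f y := by
  rw [rightOp, abs_of_pos (by norm_num), smul_eq_mul]
  ring_nf

lemma setIntegral_rightOp : ∫ x in Ioc (0:ℝ) 1, rightOp f x = ∫ y in Ioc (2/3:ℝ) 1, f y := by
  rw [← image_right_branch, integral_image_eq_integral_abs_deriv_smul measurableSet_Ioc
    (fun y _ => hasDerivWithinAt_right_branch _ y) (fun x _ y _ h => by simpa using h)]
  simp only [rightOp_smul_comp]

lemma integrableOn_rightOp (hf : IntegrableOn f (Ioc 0 1)) :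
    IntegrableOn (rightOp f) (Ioc 0 1) := by
  rw [← image_right_branch, integrableOn_image_iff_integrableOn_abs_deriv_smul measurableSet_Ioc
    (fun y _ => hasDerivWithinAt_right_branch _ y) (fun x _ y _ h => by simpa using h)]
  simp only [rightOp_smul_comp]
  exact hf.mono_set (Ioc_subset_Ioc_left (by norm_num))

lemma Pop_eq_add : Pop β f = leftOp β f + rightOp f := rfl

lemma mInt_Pop (hβ : β ∈ Ioc (0:ℝ) 1) (hf : IntegrableOn f (Ioc 0 1)) :
    mInt (Pop β f) = mInt f := by
  have h : mInt (Pop β f) = (∫ x in Ioc (0:ℝ) 1, leftOp β f x) + ∫ x in Ioc (0:ℝ) 1, rightOp f x :=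
    integral_add (integrableOn_leftOp hβ hf) (integrableOn_rightOp hf)
  rw [h, setIntegral_leftOp hβ (by norm_num), leftInv_zero hβ, setIntegral_rightOp, mInt,
    ← Ioc_union_Ioc_eq_Ioc (by norm_num : (0:ℝ) ≤ 2/3) (by norm_num : (2/3:ℝ) ≤ 1)]
  refine (setIntegral_union (Ioc_disjoint_Ioc_of_le le_rfl) measurableSet_Ioc ?_ ?_).symm
  · exact hf.mono_set (Ioc_subset_Ioc_right (by norm_num))
  · exact hf.mono_set (Ioc_subset_Ioc_left (by norm_num))

end Operators

section Decreasing

/-- Nonnegative, nonincreasing, integrable functions on `(0,1]`. -/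
structure IsDecr (f : ℝ → ℝ) : Prop where
  nonneg : ∀ x ∈ Ioc (0:ℝ) 1, 0 ≤ f x
  anti : AntitoneOn f (Ioc 0 1)
  integrable : IntegrableOn f (Ioc 0 1)

variable {β : ℝ} {f g : ℝ → ℝ}

lemma IsDecr.leftOp (hβ : β ∈ Ioc (0:ℝ) 1) (hf : IsDecr f) : IsDecr (leftOp β f) where
  nonneg x hx := div_nonneg (hf.nonneg _ (leftInv_mem_Ioc hβ hx))
    (by linarith [(Tderiv_leftInv_mem hβ (Ioc_subset_Icc_self hx)).1])
  anti x hx y hy hxy := by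
    have hx' := Ioc_subset_Icc_self hx
    have hy' := Ioc_subset_Icc_self hy
    have h := leftInv_mono hβ hx' hy' hxy
    exact div_le_div₀ (hf.nonneg _ (leftInv_mem_Ioc hβ hx))
      (hf.anti (leftInv_mem_Ioc hβ hx) (leftInv_mem_Ioc hβ hy) h)
      (by linarith [(Tderiv_leftInv_mem hβ hx').1])
      (Tderiv_left_mono hβ (leftInv_mem_Icc hβ hx') (leftInv_mem_Icc hβ hy') h)
  integrable := integrableOn_leftOp hβ hf.integrable

lemma IsDecr.rightOp (hf : IsDecr f) : IsDecr (rightOp f) where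
  nonneg x hx := div_nonneg (hf.nonneg _ (right_preimage_mem hx)) (by norm_num)
  anti x hx y hy hxy := by
    have := hf.anti (right_preimage_mem hx) (right_preimage_mem hy) (by linarith)
    simp only [_root_.rightOp]
    linarith
  integrable := integrableOn_rightOp hf.integrable

lemma IsDecr.add (hf : IsDecr f) (hg : IsDecr g) : IsDecr (f + g) where
  nonneg x hx := add_nonneg (hf.nonneg x hx) (hg.nonneg x hx)
  anti := hf.anti.add hg.anti
  integrable := hf.integrable.add hg.integrable

lemma IsDecr.Pop (hβ : β ∈ Ioc (0:ℝ) 1) (hf : IsDecr f) : IsDecr (Pop β f) :=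
  (hf.leftOp hβ).add hf.rightOp

lemma isDecr_const {c : ℝ} (hc : 0 ≤ c) : IsDecr fun _ => c where
  nonneg _ _ := hc
  anti := antitoneOn_const
  integrable := integrableOn_const (by simp)

lemma Pop_mono (hβ : β ∈ Ioc (0:ℝ) 1) (h : ∀ x ∈ Ioc (0:ℝ) 1, f x ≤ g x) :
    ∀ x ∈ Ioc (0:ℝ) 1, Pop β f x ≤ Pop β g x := by
  intro x hx
  have h1 := (Tderiv_leftInv_mem hβ (Ioc_subset_Icc_self hx)).1
  exact add_le_add
    (div_le_div_of_nonneg_right (h _ (leftInv_mem_Ioc hβ hx)) (by linarith))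
    (div_le_div_of_nonneg_right (h _ (right_preimage_mem hx)) (by norm_num))

lemma Pop_sub : Pop β (f - g) = Pop β f - Pop β g := by
  ext x; simp only [Pop, Pi.sub_apply]; ring

lemma Pop_add : Pop β (f + g) = Pop β f + Pop β g := by
  ext x; simp only [Pop, Pi.add_apply]; ring

lemma Pop_smul (c : ℝ) : Pop β (c • f) = c • Pop β f := by
  ext x; simp only [Pop, Pi.smul_apply, smul_eq_mul]; ring

end Decreasing

section Iterates

variable {β : ℕ → ℝ} {f g : ℝ → ℝ}

lemma PopCompFrom_add (k m n : ℕ) (f : ℝ → ℝ) :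
    PopCompFrom β k (m+n) f = PopCompFrom β (k+m) n (PopCompFrom β k m f) := by
  induction n with
  | zero => rfl
  | succ n ih =>
    change Pop (β (k+(m+n)+1)) (PopCompFrom β k (m+n) f) = Pop (β (k+m+n+1)) _
    rw [ih, add_assoc k m n]

lemma PopCompFrom_succ' (k n : ℕ) (f : ℝ → ℝ) :
    PopCompFrom β k (n+1) f = PopCompFrom β (k+1) n (Pop (β (k+1)) f) := by
  rw [add_comm n 1, PopCompFrom_add]
  rfl

lemma PopCompFrom_congr {β' : ℕ → ℝ} (k n : ℕ) (h : ∀ i, k < i → i ≤ k+n → β i = β' i) :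
    PopCompFrom β k n f = PopCompFrom β' k n f := by
  induction n with
  | zero => rfl
  | succ n ih =>
    change Pop (β (k+n+1)) _ = Pop (β' (k+n+1)) _
    rw [ih fun i h1 h2 => h i h1 (by omega), h (k+n+1) (by omega) (by omega)]

lemma PopCompFrom_sub (k n : ℕ) :
    PopCompFrom β k n (f - g) = PopCompFrom β k n f - PopCompFrom β k n g := by
  induction n with
  | zero => rfl
  | succ n ih =>
    change Pop _ _ = Pop _ _ - Pop _ _
    rw [ih, Pop_sub]

lemma PopCompFrom_add_fun (k n : ℕ) :
    PopCompFrom β k n (f + g) = PopCompFrom β k n f + PopCompFrom β k n g := by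
  induction n with
  | zero => rfl
  | succ n ih =>
    change Pop _ _ = Pop _ _ + Pop _ _
    rw [ih, Pop_add]

lemma PopCompFrom_smul (c : ℝ) (k n : ℕ) :
    PopCompFrom β k n (c • f) = c • PopCompFrom β k n f := by
  induction n with
  | zero => rfl
  | succ n ih =>
    change Pop _ _ = c • Pop _ _
    rw [ih, Pop_smul]

lemma PopCompFrom_mono (hβ : ∀ i, β i ∈ Ioc (0:ℝ) 1) (k n : ℕ)
    (h : ∀ x ∈ Ioc (0:ℝ) 1, f x ≤ g x) :
    ∀ x ∈ Ioc (0:ℝ) 1, PopCompFrom β k n f x ≤ PopCompFrom β k n g x := by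
  induction n with
  | zero => exact h
  | succ n ih => exact Pop_mono (hβ _) ih

lemma IsDecr.PopCompFrom (hβ : ∀ i, β i ∈ Ioc (0:ℝ) 1) (hf : IsDecr f) (k n : ℕ) :
    IsDecr (PopCompFrom β k n f) := by
  induction n with
  | zero => exact hf
  | succ n ih => exact ih.Pop (hβ _)

lemma mInt_PopCompFrom (hβ : ∀ i, β i ∈ Ioc (0:ℝ) 1) (hf : IsDecr f) (k n : ℕ) :
    mInt (PopCompFrom β k n f) = mInt f := by
  induction n with
  | zero => rfl
  | succ n ih =>
    rw [← ih]
    exact mInt_Pop (hβ _) (hf.PopCompFrom hβ k n).integrable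

/-- The preimage of `1` under `T_{β_{k+n}} ∘ ⋯ ∘ T_{β_{k+1}}` along left branches. -/
noncomputable def leftPreimage (β : ℕ → ℝ) : ℕ → ℕ → ℝ
  | _, 0 => 1
  | k, n+1 => leftInv (β (k+1)) (leftPreimage β (k+1) n)

lemma leftPreimage_mem (hβ : ∀ i, β i ∈ Ioc (0:ℝ) 1) (k n : ℕ) :
    leftPreimage β k n ∈ Ioc (0:ℝ) 1 := by
  induction n generalizing k with
  | zero => simp [leftPreimage]
  | succ n ih => exact leftInv_mem_Ioc (hβ _) (ih _)

lemma le_PopCompFrom_of_leftPreimage (hβ : ∀ i, β i ∈ Ioc (0:ℝ) 1) (hf : IsDecr f) (k n : ℕ) :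
    ∀ x ∈ Ioc (0:ℝ) 1, f (leftPreimage β k n) / 2^n ≤ PopCompFrom β k n f x := by
  induction n generalizing k f with
  | zero =>
    intro x hx
    simpa [leftPreimage, PopCompFrom] using hf.anti hx (by norm_num) hx.2
  | succ n ih =>
    intro x hx
    rw [PopCompFrom_succ']
    refine le_trans ?_ (ih (hf.Pop (hβ _)) (k+1) x hx)
    have hw := leftPreimage_mem hβ (k+1) n
    have hd := Tderiv_leftInv_mem (hβ (k+1)) (Ioc_subset_Icc_self hw)
    have h0 := hf.nonneg _ (leftInv_mem_Ioc (hβ (k+1)) hw)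
    have h1 : f (leftPreimage β k (n+1)) / 2 ≤ Pop (β (k+1)) f (leftPreimage β (k+1) n) := by
      have h2 := hf.rightOp.nonneg _ hw
      have h3 : f (leftPreimage β k (n+1)) / 2 ≤ leftOp (β (k+1)) f (leftPreimage β (k+1) n) :=
        div_le_div_of_nonneg_left h0 (by linarith [hd.1]) hd.2
      exact h3.trans (le_add_of_nonneg_right h2)
    calc f (leftPreimage β k (n+1)) / 2^(n+1) = f (leftPreimage β k (n+1)) / 2 / 2^n := by
          rw [pow_succ]; field_simp
      _ ≤ _ := div_le_div_of_nonneg_right h1 (by positivity)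

lemma setIntegral_Ioc_le {u v : ℝ} (hf : IsDecr f) (hu : 0 < u) (huv : u ≤ v) (hv : v ≤ 1) :
    ∫ x in Ioc u v, f x ≤ (v - u) * f u := by
  have h := setIntegral_mono_on (μ := volume) (s := Ioc u v) (f := f) (g := fun _ => f u)
    (hf.integrable.mono_set (Ioc_subset_Ioc hu.le hv)) (integrableOn_const (by simp))
    measurableSet_Ioc
    (fun x hx => hf.anti ⟨hu, huv.trans hv⟩ ⟨hu.trans hx.1, hx.2.trans hv⟩ hx.1.le)
  simpa [huv] using h

lemma setIntegral_split (hf : IsDecr f) {u v : ℝ} (hu : 0 ≤ u) (huv : u ≤ v) (hv : v ≤ 1) :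
    ∫ x in Ioc u 1, f x = (∫ x in Ioc u v, f x) + ∫ x in Ioc v 1, f x := by
  rw [← Ioc_union_Ioc_eq_Ioc huv hv]
  exact setIntegral_union (Ioc_disjoint_Ioc_of_le le_rfl) measurableSet_Ioc
    (hf.integrable.mono_set (Ioc_subset_Ioc hu hv))
    (hf.integrable.mono_set (Ioc_subset_Ioc (hu.trans huv) le_rfl))

/-- If constants stay bounded below under the iterates, then every decreasing function becomes
bounded below by a fixed fraction of its mass away from `0`. -/
lemma le_PopCompFrom_of_mass {c : ℝ} (hβ : ∀ i, β i ∈ Ioc (0:ℝ) 1) (hc0 : 0 ≤ c)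
    (hc : ∀ k n, ∀ x ∈ Ioc (0:ℝ) 1, c ≤ PopCompFrom β k n (fun _ => 1) x)
    (hf : IsDecr f) (k n : ℕ) : ∀ x ∈ Ioc (0:ℝ) 1,
      c/2 * (∫ y in Ioc (leftPreimage β k n) 1, f y) + c/3 * f 1
        ≤ PopCompFrom β k (n+1) f x := by
  have one_mem : (1:ℝ) ∈ Ioc (0:ℝ) 1 := by norm_num
  have hright : ∀ f, IsDecr f → ∀ k n, ∀ x ∈ Ioc (0:ℝ) 1,
      c/3 * f 1 ≤ PopCompFrom β k n (rightOp f) x := by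
    intro f hf k n x hx
    have h1 := PopCompFrom_mono hβ k n (f := (f 1 / 3) • fun _ => (1:ℝ)) (g := rightOp f)
      (fun y hy => by
        have := hf.anti (right_preimage_mem hy) one_mem (right_preimage_mem hy).2
        simp only [Pi.smul_apply, smul_eq_mul, rightOp]
        linarith) x hx
    rw [PopCompFrom_smul, Pi.smul_apply, smul_eq_mul] at h1
    nlinarith [hc k n x hx, hf.nonneg 1 one_mem]
  induction n generalizing k f with
  | zero =>
    intro x hx
    rw [PopCompFrom_succ']
    have h1 := hright f hf (k+1) 0 x hx
    have h2 := (hf.leftOp (hβ (k+1))).nonneg x hx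
    simp only [PopCompFrom, leftPreimage, Ioc_self, setIntegral_empty, Pop_eq_add,
      Pi.add_apply] at h1 ⊢
    linarith
  | succ n ih =>
    intro x hx
    rw [PopCompFrom_succ', Pop_eq_add, PopCompFrom_add_fun, Pi.add_apply]
    have hw := leftPreimage_mem hβ (k+1) n
    have h1 := hright f hf (k+1) (n+1) x hx
    have h2 := ih (hf.leftOp (hβ (k+1))) (k+1) x hx
    rw [setIntegral_leftOp (hβ (k+1)) (Ioc_subset_Icc_self hw)] at h2
    have hw' := leftPreimage_mem hβ k (n+1)
    have h3 := setIntegral_split hf (u := leftPreimage β k (n+1)) (v := 2/3) hw'.1.le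
      (leftInv_mem_Icc (hβ (k+1)) (Ioc_subset_Icc_self hw)).2 (by norm_num)
    have h4 := setIntegral_Ioc_le hf (u := 2/3) (v := 1) (by norm_num) (by norm_num) le_rfl
    have h5 : f (2/3) / 2 ≤ leftOp (β (k+1)) f 1 := by
      have hd := Tderiv_leftInv_mem (hβ (k+1)) (x := 1) (by norm_num)
      have := hf.nonneg (2/3) (by norm_num)
      rw [leftOp]
      rw [leftInv_one (hβ (k+1))] at hd ⊢
      exact div_le_div_of_nonneg_left this (by linarith [hd.1]) hd.2
    change _ = (∫ x in Ioc (leftInv (β (k+1)) (leftPreimage β (k+1) n)) (2/3), f x) + _ at h3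
    rw [h3]
    nlinarith

end Iterates

section Estimates

variable {α a : ℝ}

lemma rpow_leftInv_bounds {β : ℝ} (hα0 : 0 < α) (hα1 : α < 1) (hβ : β ∈ Ioc (0:ℝ) α) {x : ℝ}
    (hx : x ∈ Ioc (0:ℝ) 1) : ∃ t : ℝ, 0 ≤ t ∧ t ≤ 1/2 ∧ x = leftInv β x * (1 + t) ∧
      Tderiv β (leftInv β x) = 1 + (1+β) * t ∧ (leftInv β x)^α ≤ 2 * t ∧ x^α ≤ 2 * t := by
  have hβ1 : β ∈ Ioc (0:ℝ) 1 := ⟨hβ.1, hβ.2.trans hα1.le⟩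
  have hx' := Ioc_subset_Icc_self hx
  have hy := leftInv_mem_Icc hβ1 hx'
  have hpos := leftInv_pos hβ1 hx
  have ht := rpow_three_halves_mul_mem hβ1 hy
  have hT := Tmap_left hβ1 hy
  rw [Tmap_leftInv hβ1 hx'] at hT
  set y := leftInv β x
  have h1 : (3/2*y)^α ≤ (3/2*y)^β :=
    Real.rpow_le_rpow_of_exponent_ge (by linarith) (by linarith [hy.2]) hβ.2
  refine ⟨(3/2*y)^β / 2, by linarith [ht.1], by linarith [ht.2], hT, Tderiv_left hy, ?_, ?_⟩
  · have : y^α ≤ (3/2*y)^α := Real.rpow_le_rpow hpos.le (by linarith) hα0.le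
    linarith
  · have : x^α ≤ (3/2*y)^α := Real.rpow_le_rpow hx.1.le (by nlinarith [ht.2]) hα0.le
    linarith

lemma rpow_neg_leftInv {β : ℝ} (hα0 : 0 < α) (hα1 : α < 1) (hβ : β ∈ Ioc (0:ℝ) α) {x : ℝ}
    (hx : x ∈ Ioc (0:ℝ) 1) : x^(-α) + α/3 ≤ (leftInv β x)^(-α) := by
  obtain ⟨t, ht0, ht1, hxt, -, hyt, -⟩ := rpow_leftInv_bounds hα0 hα1 hβ hx
  have hpos := leftInv_pos ⟨hβ.1, hβ.2.trans hα1.le⟩ hx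
  set y := leftInv β x
  have h1 : (1+t)^(-α) ≤ 1 - α * (t/(1+t)) := by
    have e : (1+t)^(-α) = (1 + -(t/(1+t)))^α := by
      rw [Real.rpow_neg (by linarith), ← Real.inv_rpow (by linarith)]
      congr 1
      field_simp
      ring
    have hle : t/(1+t) ≤ 1 := (div_le_one (by linarith)).2 (by linarith)
    rw [e]
    have := rpow_one_add_le_one_add_mul_self (s := -(t/(1+t))) (by linarith) hα0.le hα1.le
    linarith
  have h2 : y^α / 3 ≤ t/(1+t) := by
    rw [le_div_iff₀ (by linarith)]
    have : 0 ≤ y^α := by positivity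
    nlinarith
  have h3 : y^(-α) * y^α = 1 := by
    rw [← Real.rpow_add hpos]; simp
  have h4 : 0 < y^(-α) := by positivity
  rw [hxt, Real.mul_rpow hpos.le (by linarith)]
  calc y^(-α) * (1+t)^(-α) + α/3 ≤ y^(-α) * (1 - α * (y^α/3)) + α/3 := by
        gcongr
        nlinarith
    _ = y^(-α) + α/3 * (1 - y^(-α) * y^α) := by ring
    _ = y^(-α) := by rw [h3]; ring

lemma le_rpow_neg_leftPreimage {β : ℕ → ℝ} (hα0 : 0 < α) (hα1 : α < 1)
    (hβ : ∀ i, β i ∈ Ioc (0:ℝ) α) (k n : ℕ) : α/3 * n ≤ (leftPreimage β k n)^(-α) := by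
  have hβ1 : ∀ i, β i ∈ Ioc (0:ℝ) 1 := fun i => ⟨(hβ i).1, (hβ i).2.trans hα1.le⟩
  induction n generalizing k with
  | zero => simp [leftPreimage]
  | succ n ih =>
    have := rpow_neg_leftInv hα0 hα1 (hβ (k+1)) (leftPreimage_mem hβ1 (k+1) n)
    rw [leftPreimage]
    push_cast
    linarith [ih (k+1)]

lemma leftPreimage_rpow_le {β : ℕ → ℝ} (hα0 : 0 < α) (hα1 : α < 1)
    (hβ : ∀ i, β i ∈ Ioc (0:ℝ) α) (k : ℕ) {n : ℕ} (hn : 0 < n) :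
    (leftPreimage β k n)^(1-α) ≤ (α/3 * n)^(-(1/α-1)) := by
  have hβ1 : ∀ i, β i ∈ Ioc (0:ℝ) 1 := fun i => ⟨(hβ i).1, (hβ i).2.trans hα1.le⟩
  have hw := leftPreimage_mem hβ1 k n
  have e : (leftPreimage β k n)^(1-α) = ((leftPreimage β k n)^(-α))^(-(1/α-1)) := by
    rw [← Real.rpow_mul hw.1.le]
    congr 1
    field_simp
  have hp : 1 < 1/α := (one_lt_div hα0).2 hα1
  rw [e]
  exact Real.rpow_le_rpow_of_nonpos (by positivity) (le_rpow_neg_leftPreimage hα0 hα1 hβ k n)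
    (by linarith)

lemma IsDecr.apply_two_thirds_le {f : ℝ → ℝ} (hf : IsDecr f) : f (2/3) ≤ 3/2 * mInt f := by
  have h1 : ∫ _ in Ioc (0:ℝ) (2/3), f (2/3) ≤ ∫ x in Ioc (0:ℝ) (2/3), f x :=
    setIntegral_mono_on (integrableOn_const (by simp))
      (hf.integrable.mono_set (Ioc_subset_Ioc_right (by norm_num))) measurableSet_Ioc
      fun x hx => hf.anti ⟨hx.1, hx.2.trans (by norm_num)⟩ (by norm_num) hx.2
  have h2 := setIntegral_split hf (u := 0) (v := 2/3) le_rfl (by norm_num) (by norm_num)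
  have h3 : 0 ≤ ∫ x in Ioc (2/3:ℝ) 1, f x :=
    setIntegral_nonneg measurableSet_Ioc fun x hx => hf.nonneg x ⟨by linarith [hx.1], hx.2⟩
  have h4 : ∫ _ in Ioc (0:ℝ) (2/3), f (2/3) = 2/3 * f (2/3) := by norm_num
  rw [mInt]
  linarith

lemma IsDecr.mInt_nonneg {f : ℝ → ℝ} (hf : IsDecr f) : 0 ≤ mInt f :=
  setIntegral_nonneg measurableSet_Ioc hf.nonneg

lemma Pop_le_rpow {β : ℝ} {f : ℝ → ℝ} (hα0 : 0 < α) (hα1 : α < 1) (ha : 2/(1-α) ≤ a)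
    (hβ : β ∈ Ioc (0:ℝ) α) (hf : IsDecr f)
    (h : ∀ x ∈ Ioc (0:ℝ) 1, f x ≤ a * x^(-α) * mInt f) :
    ∀ x ∈ Ioc (0:ℝ) 1, Pop β f x ≤ a * x^(-α) * mInt f := by
  intro x hx
  have hβ1 : β ∈ Ioc (0:ℝ) 1 := ⟨hβ.1, hβ.2.trans hα1.le⟩
  obtain ⟨t, ht0, ht1, hxt, hD, -, hxα⟩ := rpow_leftInv_bounds hα0 hα1 hβ hx
  have hy := leftInv_mem_Ioc hβ1 hx
  have hfy := h _ hy
  have hr : f ((x+2)/3) ≤ 3/2 * mInt f :=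
    (hf.anti (by norm_num) (right_preimage_mem hx) (by linarith [hx.1])).trans
      hf.apply_two_thirds_le
  have hM := hf.mInt_nonneg
  have hpos := hy.1
  rw [Pop, hD]
  set y := leftInv β x
  set M := mInt f
  have ha' : 2 ≤ a * (1-α) := (div_le_iff₀ (by linarith)).1 ha
  have ha0 : 0 < a := lt_of_lt_of_le (div_pos (by norm_num) (by linarith)) ha
  have hbern : (1+t)^α ≤ 1 + α * t :=
    rpow_one_add_le_one_add_mul_self (by linarith) hα0.le hα1.le
  have hyx : y^(-α) ≤ x^(-α) * (1 + α*t) := by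
    have h1t : 0 < (1+t)^α := Real.rpow_pos_of_pos (by linarith) _
    have e : y^(-α) = x^(-α) * (1+t)^α := by
      rw [hxt, Real.mul_rpow hpos.le (by linarith), Real.rpow_neg (by linarith : 0 ≤ 1+t),
        mul_assoc, inv_mul_cancel₀ h1t.ne', mul_one]
    rw [e]
    exact mul_le_mul_of_nonneg_left hbern (Real.rpow_nonneg hx.1.le _)
  have hxx : x^(-α) * x^α = 1 := by rw [← Real.rpow_add hx.1]; simp
  have hX : 0 < x^(-α) := Real.rpow_pos_of_pos hx.1 _
  have hD0 : 0 < 1 + (1+β)*t := by nlinarith [hβ.1]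
  have key : x^(-α) * (a * (1+α*t)) + (1 + (1+β)*t) / 2 ≤ a * x^(-α) * (1 + (1+β)*t) := by
    have h1 : (1 + (1+β)*t) / 2 ≤ 1 := by nlinarith [hβ1.2, hβ1.1]
    have h2 : x^(-α) * x^α ≤ x^(-α) * (a * (1-α) * t) :=
      mul_le_mul_of_nonneg_left (by nlinarith) hX.le
    have h3 : 0 ≤ x^(-α) * (a * β * t) :=
      mul_nonneg hX.le (mul_nonneg (mul_nonneg ha0.le hβ.1.le) ht0)
    nlinarith
  have h1 : f y / (1 + (1+β)*t) ≤ (a * x^(-α) - 1/2) * M := by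
    rw [div_le_iff₀ hD0]
    have h4 : f y ≤ a * (x^(-α) * (1+α*t)) * M :=
      hfy.trans (mul_le_mul_of_nonneg_right (mul_le_mul_of_nonneg_left hyx ha0.le) hM)
    have h5 : a * (x^(-α) * (1+α*t)) * M ≤
        ((a * x^(-α) - 1/2) * (1 + (1+β)*t)) * M :=
      mul_le_mul_of_nonneg_right (by linarith) hM
    linarith
  linarith

lemma PopCompFrom_le_rpow {β : ℕ → ℝ} {f : ℝ → ℝ} (hα0 : 0 < α) (hα1 : α < 1)
    (ha : 2/(1-α) ≤ a) (hβ : ∀ i, β i ∈ Ioc (0:ℝ) α) (hf : IsDecr f)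
    (h : ∀ x ∈ Ioc (0:ℝ) 1, f x ≤ a * x^(-α) * mInt f) (k n : ℕ) :
    ∀ x ∈ Ioc (0:ℝ) 1, PopCompFrom β k n f x ≤ a * x^(-α) * mInt f := by
  have hβ1 : ∀ i, β i ∈ Ioc (0:ℝ) 1 := fun i => ⟨(hβ i).1, (hβ i).2.trans hα1.le⟩
  induction n with
  | zero => exact h
  | succ n ih =>
    have hm := mInt_PopCompFrom hβ1 hf k n
    rw [← hm] at ih ⊢
    exact Pop_le_rpow hα0 hα1 ha (hβ _) (hf.PopCompFrom hβ1 k n) ih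

lemma setIntegral_le_rpow {f : ℝ → ℝ} {K w : ℝ} (hα1 : α < 1) (hf : IsDecr f)
    (h : ∀ x ∈ Ioc (0:ℝ) 1, f x ≤ K * x^(-α)) (hw : w ∈ Ioc (0:ℝ) 1) :
    ∫ x in Ioc 0 w, f x ≤ K / (1-α) * w^(1-α) := by
  have hint : IntervalIntegrable (fun x : ℝ => x^(-α)) volume 0 w :=
    intervalIntegral.intervalIntegrable_rpow' (by linarith)
  have h1 : ∫ x in Ioc 0 w, f x ≤ ∫ x in Ioc 0 w, K * x^(-α) :=
    setIntegral_mono_on (hf.integrable.mono_set (Ioc_subset_Ioc_right hw.2))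
      (((intervalIntegrable_iff_integrableOn_Ioc_of_le hw.1.le).1 hint).const_mul K)
      measurableSet_Ioc fun x hx => h x ⟨hx.1, hx.2.trans hw.2⟩
  refine h1.trans_eq ?_
  rw [integral_const_mul, ← intervalIntegral.integral_of_le hw.1.le,
    integral_rpow (Or.inl (by linarith)), Real.zero_rpow (by linarith)]
  rw [show -α + 1 = 1 - α by ring]
  ring

lemma exists_forall_le_PopCompFrom_one (hα0 : 0 < α) (hα1 : α < 1) (ha : 2/(1-α) ≤ a) :
    ∃ c : ℝ, 0 < c ∧ c ≤ 1 ∧ ∀ β : ℕ → ℝ, (∀ i, β i ∈ Ioc (0:ℝ) α) →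
      ∀ k n, ∀ x ∈ Ioc (0:ℝ) 1, c ≤ PopCompFrom β k n (fun _ => 1) x := by
  have ha2 : 2 ≤ 2/(1-α) := by rw [le_div_iff₀ (by linarith)]; linarith
  have hp : 0 < 1/α - 1 := by linarith [(one_lt_div hα0).2 hα1]
  have hlim : Filter.Tendsto (fun n : ℕ => a/(1-α) * (α/3 * (n:ℝ))^(-(1/α-1)))
      Filter.atTop (nhds (a/(1-α) * 0)) :=
    ((tendsto_rpow_neg_atTop hp).comp
      (tendsto_natCast_atTop_atTop.const_mul_atTop (by positivity))).const_mul _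
  rw [mul_zero] at hlim
  obtain ⟨J, hJ, hJ0⟩ := ((hlim.eventually (gt_mem_nhds (by norm_num : (0:ℝ) < 1/2))).and
    (Filter.eventually_gt_atTop 0)).exists
  refine ⟨1 / 2 / 2^J, by positivity, ?_, ?_⟩
  · have : (1:ℝ) ≤ 2^J := one_le_pow₀ (by norm_num)
    rw [div_le_one (by positivity)]
    linarith
  intro β hβ k n x hx
  have hβ1 : ∀ i, β i ∈ Ioc (0:ℝ) 1 := fun i => ⟨(hβ i).1, (hβ i).2.trans hα1.le⟩
  have hone : IsDecr fun _ => (1:ℝ) := isDecr_const zero_le_one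
  have mone : mInt (fun _ => (1:ℝ)) = 1 := by simp [mInt]
  rcases lt_or_ge n J with hn | hn
  · refine le_trans ?_ (le_PopCompFrom_of_leftPreimage hβ1 hone k n x hx)
    have : (2:ℝ)^n ≤ 2^J := pow_le_pow_right₀ (by norm_num) hn.le
    gcongr
    norm_num
  · obtain ⟨i, rfl⟩ := Nat.exists_eq_add_of_le' hn
    rw [PopCompFrom_add]
    set f := PopCompFrom β k i fun _ => 1
    have hf : IsDecr f := hone.PopCompFrom hβ1 k i
    have hfm : mInt f = 1 := (mInt_PopCompFrom hβ1 hone k i).trans mone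
    have hfb : ∀ x ∈ Ioc (0:ℝ) 1, f x ≤ a * x^(-α) := by
      intro x hx
      have := PopCompFrom_le_rpow hα0 hα1 ha hβ hone (fun x hx => by
        have : 1 ≤ x^(-α) := Real.one_le_rpow_of_pos_of_le_one_of_nonpos hx.1 hx.2 (by linarith)
        rw [mone]
        nlinarith) k i x hx
      rwa [mone, mul_one] at this
    refine le_trans ?_ (le_PopCompFrom_of_leftPreimage hβ1 hf (k+i) J x hx)
    have hw := leftPreimage_mem hβ1 (k+i) J
    have hwb := leftPreimage_rpow_le hα0 hα1 hβ (k+i) hJ0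
    set w := leftPreimage β (k+i) J
    have h1 := setIntegral_le_rpow hα1 hf hfb hw
    have h2 : a/(1-α) * w^(1-α) ≤ 1/2 :=
      (mul_le_mul_of_nonneg_left hwb (div_nonneg (by linarith) (by linarith))).trans hJ.le
    have h3 := setIntegral_split hf le_rfl hw.1.le hw.2
    have h4 := setIntegral_Ioc_le hf hw.1 hw.2 le_rfl
    have h5 := hf.nonneg w hw
    rw [mInt] at hfm
    gcongr
    nlinarith [hw.1]

end Estimates

section LossOfMemory

variable {α a : ℝ} {β : ℕ → ℝ} {φ ψ : ℝ → ℝ}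

/-- One round of coupling: after `n+1` steps a constant proportional to the mass, up to the mass
near the neutral fixed point, can be subtracted while staying nonnegative. -/
lemma coupling_step {c K M μ η : ℝ} {f : ℝ → ℝ} (hα1 : α < 1)
    (hβ : ∀ i, β i ∈ Ioc (0:ℝ) 1) (hc0 : 0 ≤ c)
    (hc : ∀ k n, ∀ x ∈ Ioc (0:ℝ) 1, c ≤ PopCompFrom β k n (fun _ => 1) x)
    (hf : IsDecr f) (hfm : mInt f = μ) (hfb : ∀ x ∈ Ioc (0:ℝ) 1, f x ≤ K * M * x^(-α))
    (hK : 0 ≤ K) (hM : 0 ≤ M) (k n : ℕ) (hη : (leftPreimage β k n)^(1-α) ≤ η) :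
    let q := max 0 (c/2 * (μ - K/(1-α) * η * M))
    IsDecr (fun x => PopCompFrom β k (n+1) f x - q) ∧
      mInt (fun x => PopCompFrom β k (n+1) f x - q) = μ - q := by
  intro q
  have hP := hf.PopCompFrom hβ k (n+1)
  have hw := leftPreimage_mem hβ k n
  have hq : ∀ x ∈ Ioc (0:ℝ) 1, q ≤ PopCompFrom β k (n+1) f x := by
    intro x hx
    refine max_le (hP.nonneg x hx) (le_trans ?_ (le_PopCompFrom_of_mass hβ hc0 hc hf k n x hx))
    have h1 := setIntegral_split hf le_rfl hw.1.le hw.2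
    have h2 := setIntegral_le_rpow hα1 hf hfb hw
    have h3 : K * M / (1-α) * (leftPreimage β k n)^(1-α) ≤ K/(1-α) * η * M := by
      calc K * M / (1-α) * (leftPreimage β k n)^(1-α)
          ≤ K * M / (1-α) * η := mul_le_mul_of_nonneg_left hη
            (div_nonneg (mul_nonneg hK hM) (by linarith))
        _ = K/(1-α) * η * M := by ring
    have h4 := hf.nonneg 1 (by norm_num)
    rw [mInt] at hfm
    have h5 : μ - K/(1-α) * η * M ≤ ∫ x in Ioc (leftPreimage β k n) 1, f x := by linarith
    nlinarith
  refine ⟨⟨fun x hx => sub_nonneg.2 (hq x hx),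
    fun x hx y hy hxy => sub_le_sub_right (hP.anti hx hy hxy) q,
    hP.integrable.sub (integrableOn_const (by simp))⟩, ?_⟩
  rw [← hfm, ← mInt_PopCompFrom hβ hf k (n+1), mInt, integral_sub hP.integrable
    (integrableOn_const (by simp))]
  simp [mInt]

/-- Iterated coupling of two densities of equal mass in blocks of length `n+1`. -/
lemma exists_coupling {c M η : ℝ} (hα0 : 0 < α) (hα1 : α < 1) (ha : 2/(1-α) ≤ a)
    (hβ : ∀ i, β i ∈ Ioc (0:ℝ) α) (hc0 : 0 ≤ c) (hc1 : c ≤ 1)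
    (hc : ∀ k n, ∀ x ∈ Ioc (0:ℝ) 1, c ≤ PopCompFrom β k n (fun _ => 1) x)
    (hφ : IsDecr φ) (hψ : IsDecr ψ) (hφm : mInt φ = M) (hψm : mInt ψ = M)
    (hφb : ∀ x ∈ Ioc (0:ℝ) 1, φ x ≤ a * x^(-α) * M)
    (hψb : ∀ x ∈ Ioc (0:ℝ) 1, ψ x ≤ a * x^(-α) * M) (n : ℕ)
    (hη0 : 0 ≤ η) (hη : ∀ k, (leftPreimage β k n)^(1-α) ≤ η) (j : ℕ) :
    ∃ r s : ℝ → ℝ, ∃ μ : ℝ, IsDecr r ∧ IsDecr s ∧ mInt r = μ ∧ mInt s = μ ∧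
      μ ≤ M * ((1 - c/2)^j + a/(1-α) * η) ∧
      (∀ x ∈ Ioc (0:ℝ) 1, r x ≤ PopComp β ((n+1)*j) φ x) ∧
      (∀ x ∈ Ioc (0:ℝ) 1, s x ≤ PopComp β ((n+1)*j) ψ x) ∧
      PopComp β ((n+1)*j) φ - PopComp β ((n+1)*j) ψ = r - s := by
  have hβ1 : ∀ i, β i ∈ Ioc (0:ℝ) 1 := fun i => ⟨(hβ i).1, (hβ i).2.trans hα1.le⟩
  have hM : 0 ≤ M := hφm ▸ hφ.mInt_nonneg
  have ha0 : 0 ≤ a := (div_nonneg (by norm_num) (by linarith)).trans ha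
  have hB : 0 ≤ a/(1-α) := div_nonneg ha0 (by linarith)
  induction j with
  | zero =>
    refine ⟨φ, ψ, M, hφ, hψ, hφm, hψm, ?_, fun _ _ => le_rfl, fun _ _ => le_rfl, rfl⟩
    have := mul_nonneg hM (mul_nonneg hB hη0)
    rw [pow_zero]
    linarith
  | succ j ih =>
    obtain ⟨r, s, μ, hr, hs, hrm, hsm, hμ, hrφ, hsψ, hrs⟩ := ih
    have hbound : ∀ {f g : ℝ → ℝ}, IsDecr f → mInt f = M →
        (∀ x ∈ Ioc (0:ℝ) 1, f x ≤ a * x^(-α) * M) →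
        (∀ x ∈ Ioc (0:ℝ) 1, g x ≤ PopComp β ((n+1)*j) f x) →
        ∀ x ∈ Ioc (0:ℝ) 1, g x ≤ a * M * x^(-α) := by
      intro f g hf hfm hfb hgf x hx
      have := PopCompFrom_le_rpow hα0 hα1 ha hβ hf (hfm.symm ▸ hfb) 0 ((n+1)*j) x hx
      rw [hfm] at this
      linarith [hgf x hx, show PopCompFrom β 0 ((n+1)*j) f x = PopComp β ((n+1)*j) f x from rfl]
    have hstep : ∀ f : ℝ → ℝ, PopComp β ((n+1)*(j+1)) f =
        PopCompFrom β ((n+1)*j) (n+1) (PopComp β ((n+1)*j) f) := by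
      intro f
      rw [PopComp, mul_add, mul_one, PopCompFrom_add, zero_add]
      rfl
    obtain ⟨hr', hrm'⟩ := coupling_step hα1 hβ1 hc0 hc hr hrm (hbound hφ hφm hφb hrφ) ha0 hM
      ((n+1)*j) n (hη _)
    obtain ⟨hs', hsm'⟩ := coupling_step hα1 hβ1 hc0 hc hs hsm (hbound hψ hψm hψb hsψ) ha0 hM
      ((n+1)*j) n (hη _)
    set q := max 0 (c/2 * (μ - a/(1-α) * η * M)) with hq
    have hq0 : 0 ≤ q := le_max_left _ _
    have hq1 : c/2 * (μ - a/(1-α) * η * M) ≤ q := le_max_right _ _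
    refine ⟨_, _, _, hr', hs', hrm', hsm', ?_, ?_, ?_, ?_⟩
    · have h1 : (1 - c/2) * μ ≤ (1 - c/2) * (M * ((1 - c/2)^j + a/(1-α) * η)) :=
        mul_le_mul_of_nonneg_left hμ (by linarith)
      rw [pow_succ]
      linarith
    · intro x hx
      rw [hstep]
      linarith [PopCompFrom_mono hβ1 ((n+1)*j) (n+1) hrφ x hx]
    · intro x hx
      rw [hstep]
      linarith [PopCompFrom_mono hβ1 ((n+1)*j) (n+1) hsψ x hx]
    · rw [hstep, hstep, ← PopCompFrom_sub, hrs, PopCompFrom_sub]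
      ext x
      simp

lemma integral_abs_sub_le_of_coupling {r s : ℝ → ℝ} (hβ : ∀ i, β i ∈ Ioc (0:ℝ) 1)
    (hr : IsDecr r) (hs : IsDecr s) {m N : ℕ} (hmN : m ≤ N)
    (h : PopComp β m φ - PopComp β m ψ = r - s) :
    ∫ x in Ioc (0:ℝ) 1, |PopComp β N φ x - PopComp β N ψ x| ≤ mInt r + mInt s := by
  obtain ⟨i, rfl⟩ := Nat.exists_eq_add_of_le hmN
  have hsplit : ∀ x, PopComp β (m+i) φ x - PopComp β (m+i) ψ x =
      PopCompFrom β m i r x - PopCompFrom β m i s x := by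
    intro x
    have e : PopComp β (m+i) φ - PopComp β (m+i) ψ =
        PopCompFrom β m i r - PopCompFrom β m i s := by
      rw [← PopCompFrom_sub, ← h, PopCompFrom_sub, PopComp, PopComp, PopCompFrom_add,
        PopCompFrom_add, zero_add]
    exact congrFun e x
  have hr' := hr.PopCompFrom hβ m i
  have hs' := hs.PopCompFrom hβ m i
  rw [← mInt_PopCompFrom hβ hr m i, ← mInt_PopCompFrom hβ hs m i, mInt, mInt,
    ← integral_add hr'.integrable hs'.integrable]
  simp only [hsplit]
  refine setIntegral_mono_on (hr'.integrable.sub hs'.integrable).abs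
    (hr'.integrable.add hs'.integrable) measurableSet_Ioc fun x hx => ?_
  rw [abs_le]
  constructor <;> linarith [hr'.nonneg x hx, hs'.nonneg x hx]

/-- Choice of block length: `N` steps are cut into about `log N` blocks of length about
`N / log N`. -/
lemma exists_rate {p γ κ B : ℝ} (hp : 0 < p) (hγ0 : 0 < γ) (hγ1 : γ < 1) (hκ : 0 < κ)
    (hB : 0 ≤ B) : ∃ C > 0, ∀ N : ℕ, 1 < N →
      1 ≤ C * ((N:ℝ)^(-p) * (Real.log N)^(p+1)) ∨
      ∃ n j : ℕ, 0 < n ∧ (n+1) * j ≤ N ∧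
        (1-γ)^j + B * (κ * n)^(-p) ≤ C * ((N:ℝ)^(-p) * (Real.log N)^(p+1)) := by
  set H := p/γ + 2 with hH
  have hH0 : 0 < H := by positivity
  have h2p : (0:ℝ) < 2^(p+1) := by positivity
  have h4H : 0 < (4*H)^p := by positivity
  have hκH : 0 < (κ/(2*H))^(-p) := by positivity
  refine ⟨2 * (4*H)^p + (2^(p+1) + 2 * B * (κ/(2*H))^(-p)), by positivity, fun N hN => ?_⟩
  have hN1 : (1:ℝ) < N := by exact_mod_cast hN
  have hN2 : (2:ℝ) ≤ N := by exact_mod_cast hN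
  have hlog : 1/2 ≤ Real.log N := by
    have := Real.log_le_log (by norm_num) hN2
    linarith [Real.log_two_gt_d9]
  set l := Real.log N
  have hl0 : 0 < l := by linarith
  set X := (N:ℝ) / l with hX
  have hX0 : 0 < X := by positivity
  have hXp : X^(-p) ≤ 2 * ((N:ℝ)^(-p) * l^(p+1)) := by
    have e : X^(-p) = (N:ℝ)^(-p) * l^p := by
      rw [hX, Real.div_rpow (by linarith) hl0.le, Real.rpow_neg hl0.le, div_inv_eq_mul]
    rw [e, Real.rpow_add hl0, Real.rpow_one]
    have : 0 < (N:ℝ)^(-p) * l^p := by positivity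
    nlinarith
  have hNp : (N:ℝ)^(-p) ≤ 2^(p+1) * ((N:ℝ)^(-p) * l^(p+1)) := by
    have h1 : 1 ≤ (2*l)^(p+1) := Real.one_le_rpow (by linarith) (by linarith)
    rw [Real.mul_rpow (by norm_num) hl0.le] at h1
    have : 0 < (N:ℝ)^(-p) := by positivity
    nlinarith
  have hY : 0 < (N:ℝ)^(-p) * l^(p+1) := by positivity
  set Y := (N:ℝ)^(-p) * l^(p+1)
  rcases lt_or_ge X (4*H) with hsmall | hlarge
  · left
    have h1 : (4*H)^(-p) ≤ X^(-p) :=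
      Real.rpow_le_rpow_of_nonpos hX0 hsmall.le (by linarith)
    have h2 : 1 ≤ (4*H)^p * X^(-p) := by
      rw [Real.rpow_neg (by positivity)] at h1
      calc 1 = (4*H)^p * ((4*H)^p)⁻¹ := (mul_inv_cancel₀ h4H.ne').symm
        _ ≤ _ := mul_le_mul_of_nonneg_left h1 h4H.le
    have h3 : (4*H)^p * X^(-p) ≤ (4*H)^p * (2 * Y) := mul_le_mul_of_nonneg_left hXp h4H.le
    have h4 : 0 ≤ (2^(p+1) + 2 * B * (κ/(2*H))^(-p)) * Y := by positivity
    linarith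
  · right
    set j := ⌈p/γ * l⌉₊ with hj
    have hj1 : p/γ * l ≤ j := Nat.le_ceil _
    have hj0 : (0:ℝ) < j := lt_of_lt_of_le (by positivity) hj1
    have hj2 : (j:ℝ) ≤ H * l := by
      have := (Nat.ceil_lt_add_one (by positivity : 0 ≤ p/γ * l)).le
      rw [hH]
      linarith
    have hdiv : X / H ≤ N / j := by
      rw [hX, div_div]
      exact div_le_div_of_nonneg_left (by linarith) hj0 (by linarith)
    have hfloor : (N:ℝ) / j < (N / j : ℕ) + 1 := by
      rw [← Nat.floor_div_eq_div (K := ℝ)]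
      exact Nat.lt_floor_add_one _
    have hXH : 4 ≤ X / H := (le_div_iff₀ hH0).2 hlarge
    have hq : 2 ≤ N / j := by
      have : (2:ℝ) < (N / j : ℕ) := by linarith
      exact_mod_cast this.le
    obtain ⟨n, hn⟩ : ∃ n, N / j = n + 1 := ⟨N / j - 1, by omega⟩
    rw [hn] at hfloor hq
    push_cast at hfloor
    have hnX : X / (2*H) ≤ n := by
      have : X / (2*H) = X / H / 2 := by rw [mul_comm 2 H, ← div_div]
      rw [this]
      linarith
    refine ⟨n, j, by omega, hn ▸ Nat.div_mul_le_self N j, ?_⟩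
    have h1 : (1-γ)^j ≤ (N:ℝ)^(-p) := by
      calc (1-γ)^j ≤ (Real.exp (-γ))^j :=
            pow_le_pow_left₀ (by linarith) (by linarith [Real.add_one_le_exp (-γ)]) _
        _ = Real.exp (j * -γ) := (Real.exp_nat_mul _ _).symm
        _ ≤ Real.exp (l * -p) := by
            apply Real.exp_le_exp.2
            have : p/γ * l * γ = p * l := by field_simp
            nlinarith
        _ = (N:ℝ)^(-p) := (Real.rpow_def_of_pos (by linarith) _).symm
    have h2 : (κ * n)^(-p) ≤ (κ/(2*H))^(-p) * X^(-p) := by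
      rw [← Real.mul_rpow (by positivity) hX0.le]
      refine Real.rpow_le_rpow_of_nonpos (by positivity) ?_ (by linarith)
      calc κ/(2*H) * X = κ * (X/(2*H)) := by ring
        _ ≤ κ * n := mul_le_mul_of_nonneg_left hnX hκ.le
    have h3 : B * (κ * n)^(-p) ≤ B * ((κ/(2*H))^(-p) * (2 * Y)) :=
      mul_le_mul_of_nonneg_left
        (h2.trans (mul_le_mul_of_nonneg_left hXp hκH.le)) hB
    have h4 : 0 ≤ 2 * (4*H)^p * Y := by positivity
    linarith

lemma memC2.isDecr {f : ℝ → ℝ} (h : memC2 α a f) : IsDecr f :=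
  ⟨h.1.2.1, h.1.2.2.1, h.2.1⟩

lemma L1norm_eq_mInt {f : ℝ → ℝ} (hf : IsDecr f) : L1norm f = mInt f :=
  setIntegral_congr_fun measurableSet_Ioc fun x hx => abs_of_nonneg (hf.nonneg x hx)

end LossOfMemory

/-- Main theorem, cone observables: there is a constant `C_α` (depending
only on `α` and `a`) such that for all `φ, ψ ∈ C₂` with `∫φ dm = ∫ψ dm`, every `n > 1`
and every sequence `β₁, …, β_n ∈ (0,α]`,
`∫ |P_{β_n} ∘ ⋯ ∘ P_{β_1} φ - P_{β_n} ∘ ⋯ ∘ P_{β_1} ψ| dm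
  ≤ C_α (‖φ‖₁ + ‖ψ‖₁) n^(1-1/α) (log n)^(1/α)`. -/
theorem polynomial_loss_of_memory_cone (α a : ℝ) (hα0 : 0 < α) (hα1 : α < 1)
    (ha : (2:ℝ)^α * (2+α) / (1-α) ≤ a) :
    ∃ C > 0, ∀ φ ψ : ℝ → ℝ, memC2 α a φ → memC2 α a ψ → mInt φ = mInt ψ →
      ∀ n : ℕ, 1 < n → ∀ β : ℕ → ℝ, (∀ i, 1 ≤ i → i ≤ n → β i ∈ Set.Ioc (0:ℝ) α) →
      (∫ x in Set.Ioc (0:ℝ) 1, |PopComp β n φ x - PopComp β n ψ x|)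
        ≤ C * (L1norm φ + L1norm ψ) * (n:ℝ)^(1-1/α) * (Real.log n)^(1/α) := by
  have hα' : 0 < 1 - α := by linarith
  have ha' : 2/(1-α) ≤ a := by
    refine le_trans (div_le_div_of_nonneg_right ?_ hα'.le) ha
    have := Real.one_le_rpow (x := 2) (by norm_num) hα0.le
    nlinarith
  have ha0 : 0 ≤ a := (div_nonneg (by norm_num) hα'.le).trans ha'
  have hp : 0 < 1/α - 1 := by linarith [(one_lt_div hα0).2 hα1]
  obtain ⟨c, hc0, hc1, hc⟩ := exists_forall_le_PopCompFrom_one hα0 hα1 ha'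
  obtain ⟨C, hC0, hC⟩ := exists_rate (γ := c/2) (κ := α/3) (B := a/(1-α)) hp (by linarith)
    (by linarith) (by linarith) (div_nonneg ha0 hα'.le)
  refine ⟨C, hC0, fun φ ψ hφ hψ hm n hn β₀ hβ₀ => ?_⟩
  obtain ⟨β, hβ, hββ₀⟩ : ∃ β : ℕ → ℝ, (∀ i, β i ∈ Ioc (0:ℝ) α) ∧
      ∀ i, 0 < i → i ≤ 0 + n → β₀ i = β i := by
    classical
    refine ⟨fun i => if 1 ≤ i ∧ i ≤ n then β₀ i else α, fun i => ?_, fun i h1 h2 => ?_⟩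
    · dsimp only
      split_ifs with h
      · exact hβ₀ i h.1 h.2
      · exact ⟨hα0, le_rfl⟩
    · exact (if_pos ⟨h1, by omega⟩).symm
  have hcongr : ∀ f, PopComp β₀ n f = PopComp β n f := fun f => PopCompFrom_congr 0 n hββ₀
  rw [hcongr, hcongr]
  have hβ1 : ∀ i, β i ∈ Ioc (0:ℝ) 1 := fun i => ⟨(hβ i).1, (hβ i).2.trans hα1.le⟩
  have hM := hφ.isDecr.mInt_nonneg
  rw [L1norm_eq_mInt hφ.isDecr, L1norm_eq_mInt hψ.isDecr, ← hm]
  have hexp : (n:ℝ)^(1-1/α) * (Real.log n)^(1/α) =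
      (n:ℝ)^(-(1/α-1)) * (Real.log n)^(1/α-1+1) := by
    rw [neg_sub, sub_add_cancel]
  rw [mul_assoc (C * _), hexp]
  rcases hC n hn with h1 | ⟨l, j, hl, hlj, h1⟩
  · refine (integral_abs_sub_le_of_coupling hβ1 hφ.isDecr hψ.isDecr (Nat.zero_le n) rfl).trans ?_
    rw [← hm]
    nlinarith
  · obtain ⟨r, s, μ, hr, hs, hrm, hsm, hμ, -, -, hrs⟩ := exists_coupling hα0 hα1 ha' hβ hc0.le hc1
      (hc β hβ) hφ.isDecr hψ.isDecr rfl hm.symm hφ.2.2 (hm ▸ hψ.2.2) l (by positivity)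
      (fun k => leftPreimage_rpow_le hα0 hα1 hβ k hl) j
    refine (integral_abs_sub_le_of_coupling hβ1 hr hs hlj hrs).trans ?_
    rw [hrm, hsm]
    have := hμ.trans (mul_le_mul_of_nonneg_left h1 hM)
    linarith
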